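/- arXiv:1703.10744 — 4 statements merged into one kernel-verified Lean document; each statement's English description precedes it below -/
import Mathlib

section
/- Let A > 0, σ > 0, γ ≥ 0, v₀ > 0, and ρ₀ ∈ (0,1). Let 0 ≤ t₀ < t₁ and let z₀ ∈ ℝ satisfy |z₀| ≤ ρ₀·e^{-σγ}·v₀·e^{-σ t₀} and |z₀|·e^{A(t₁ - t₀)} = v₀·e^{-σ t₁}. Then t₁ - t₀ ≥ -ln(ρ₀·e^{-σγ})/(A + σ). -/
/-- Lower bound on inter-event intervals for the scalar event-triggered scheme:
if a reception at time `t₀` resets the error magnitude to at most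
`ρ₀ e^{-σγ} v₀ e^{-σ t₀}` and the next triggering time `t₁` satisfies
`|z₀| e^{A (t₁ - t₀)} = v₀ e^{-σ t₁}`, then
`t₁ - t₀ ≥ -ln(ρ₀ e^{-σγ}) / (A + σ)`. -/
theorem triggering_interval_lower_bound
    (A σ γ v₀ ρ₀ : ℝ) (hA : 0 < A) (hσ : 0 < σ) (hγ : 0 ≤ γ) (hv₀ : 0 < v₀)
    (hρ₀ : ρ₀ ∈ Set.Ioo (0 : ℝ) 1)
    (t₀ t₁ : ℝ) (ht₀ : 0 ≤ t₀) (ht₀₁ : t₀ < t₁) (z₀ : ℝ)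
    (hreset : |z₀| ≤ ρ₀ * Real.exp (-σ * γ) * v₀ * Real.exp (-σ * t₀))
    (htrig : |z₀| * Real.exp (A * (t₁ - t₀)) = v₀ * Real.exp (-σ * t₁)) :
    t₁ - t₀ ≥ -Real.log (ρ₀ * Real.exp (-σ * γ)) / (A + σ) := by
  have hk : 0 < ρ₀ * Real.exp (-σ * γ) := mul_pos hρ₀.1 (Real.exp_pos _)
  have hexp : Real.exp (-((A + σ) * (t₁ - t₀))) ≤ ρ₀ * Real.exp (-σ * γ) := by
    have hE : 0 < v₀ * Real.exp (-σ * t₀ + A * (t₁ - t₀)) := mul_pos hv₀ (Real.exp_pos _)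
    refine le_of_mul_le_mul_right ?_ hE
    calc Real.exp (-((A + σ) * (t₁ - t₀))) * (v₀ * Real.exp (-σ * t₀ + A * (t₁ - t₀)))
        = v₀ * Real.exp (-σ * t₁) := by
          rw [mul_left_comm, ← Real.exp_add]
          ring_nf
      _ = |z₀| * Real.exp (A * (t₁ - t₀)) := htrig.symm
      _ ≤ ρ₀ * Real.exp (-σ * γ) * v₀ * Real.exp (-σ * t₀) * Real.exp (A * (t₁ - t₀)) := by
          gcongr
      _ = ρ₀ * Real.exp (-σ * γ) * (v₀ * Real.exp (-σ * t₀ + A * (t₁ - t₀))) := by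
          rw [Real.exp_add]
          ring
  have hlog := (Real.le_log_iff_exp_le hk).2 hexp
  rw [ge_iff_le, div_le_iff₀ (add_pos hA hσ)]
  linarith
end

section
/- Let A > 0, σ > 0, ρ₀ ∈ (0,1), and ν ≥ 1. Then the function γ ↦ (A + σ)/(ln ν + ln(2 + e^{σγ}/ρ₀)) · log₂((e^{Aγ} − 1)/(ρ₀·e^{-σγ})) tends to ((A + σ)/ln 2)·(1 + A/σ) as γ → ∞. -/
open Filter

/-- If `f t * exp (-(k * t))` has a positive limit, then `f` has exponential growth rate `k`. -/
theorem tendsto_log_div_of_tendsto_mul_exp {f : ℝ → ℝ} {k c : ℝ} (hc : 0 < c)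
    (hf : Tendsto (fun t => f t * Real.exp (-(k * t))) atTop (nhds c)) :
    Tendsto (fun t => Real.log (f t) / t) atTop (nhds k) := by
  have h : Tendsto (fun t => Real.log (f t * Real.exp (-(k * t))) / t + k) atTop (nhds (0 + k)) :=
    ((hf.log hc.ne').div_atTop tendsto_id).add_const k
  rw [zero_add] at h
  refine h.congr' ?_
  filter_upwards [hf.eventually_ne hc.ne', eventually_gt_atTop 0] with t ht ht0
  rw [Real.log_mul (left_ne_zero_of_mul ht) (Real.exp_ne_zero _), Real.log_exp]
  field_simp
  ring

theorem tendsto_exp_neg_mul_atTop {k : ℝ} (hk : 0 < k) :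
    Tendsto (fun t : ℝ => Real.exp (-(k * t))) atTop (nhds 0) :=
  Real.tendsto_exp_neg_atTop_nhds_zero.comp (tendsto_id.const_mul_atTop hk)

/-- Asymptote of the necessary information transmission rate for event-triggered control
(Remark 6): as the worst-case delay `γ → ∞`, the bound of Theorem 4 converges to
`((A + σ)/ln 2)(1 + A/σ)`. -/
theorem necessary_rate_tendsto_asymptote
    (A σ ρ₀ ν : ℝ) (hA : 0 < A) (hσ : 0 < σ) (hρ₀ : ρ₀ ∈ Set.Ioo (0 : ℝ) 1) (hν : 1 ≤ ν) :
    Tendsto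
      (fun γ : ℝ =>
        (A + σ) / (Real.log ν + Real.log (2 + Real.exp (σ * γ) / ρ₀)) *
          Real.logb 2 ((Real.exp (A * γ) - 1) / (ρ₀ * Real.exp (-σ * γ))))
      atTop
      (nhds ((A + σ) / Real.log 2 * (1 + A / σ))) := by
  obtain ⟨hρ, -⟩ := hρ₀
  have hden : Tendsto (fun γ => Real.log (2 + Real.exp (σ * γ) / ρ₀) / γ) atTop (nhds σ) := by
    refine tendsto_log_div_of_tendsto_mul_exp (inv_pos.2 hρ) ?_
    have h := ((tendsto_exp_neg_mul_atTop hσ).const_mul 2).add_const ρ₀⁻¹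
    rw [mul_zero, zero_add] at h
    refine h.congr fun γ => ?_
    rw [Real.exp_neg]
    field_simp
  have hnum : Tendsto
      (fun γ => Real.log ((Real.exp (A * γ) - 1) / (ρ₀ * Real.exp (-σ * γ))) / γ)
      atTop (nhds (A + σ)) := by
    refine tendsto_log_div_of_tendsto_mul_exp (inv_pos.2 hρ) ?_
    have h := ((tendsto_exp_neg_mul_atTop hA).const_sub 1).mul_const ρ₀⁻¹
    rw [sub_zero, one_mul] at h
    refine h.congr fun γ => ?_
    rw [add_mul, neg_add, Real.exp_add, neg_mul, Real.exp_neg (A * γ)]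
    field_simp
  have hν0 : Tendsto (fun γ : ℝ => Real.log ν / γ) atTop (nhds 0) :=
    tendsto_const_nhds.div_atTop tendsto_id
  have h := (hnum.div (hν0.add hden) (by simpa using hσ.ne')).const_mul ((A + σ) / Real.log 2)
  have hlim : (A + σ) / Real.log 2 * ((A + σ) / (0 + σ)) =
      (A + σ) / Real.log 2 * (1 + A / σ) := by
    rw [zero_add, add_comm 1, add_div A σ σ, div_self hσ.ne']
  rw [hlim] at h
  refine h.congr' ?_
  filter_upwards [eventually_gt_atTop 0] with γ hγ
  rw [Pi.div_apply, ← add_div, div_div_div_cancel_right₀ hγ.ne', Real.logb]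
  ring
end

section
/- Let A > 0, σ > 0, ρ₀ ∈ (0,1), and b > 1. Then the function γ ↦ (A + σ)/(−ln(ρ₀·e^{-σγ})) · (1 + log₂( bγ(A+σ) / ln(1 + ρ₀·e^{-(σ+A)γ}) )) tends to ((A + σ)/ln 2)·(1 + A/σ) as γ → ∞. -/
open Filter

theorem tendsto_log_one_add_div_self :
    Tendsto (fun x : ℝ => Real.log (1 + x) / x) (nhdsWithin 0 {0}ᶜ) (nhds 1) := by
  have h : HasDerivAt (fun x : ℝ => Real.log (1 + x)) 1 0 := by
    simpa using ((hasDerivAt_id (0 : ℝ)).const_add 1).log (by simp)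
  refine (hasDerivAt_iff_tendsto_slope.mp h).congr fun x => ?_
  simp [slope_def_field]

/-- Asymptote of the sufficient information transmission rate for event-triggered control
(Remark 6): as the worst-case delay `γ → ∞`, the bound of Theorem 5 converges to
`((A + σ)/ln 2)(1 + A/σ)`. -/
theorem sufficient_rate_tendsto_asymptote
    (A σ ρ₀ b : ℝ) (hA : 0 < A) (hσ : 0 < σ) (hρ₀ : ρ₀ ∈ Set.Ioo (0 : ℝ) 1) (hb : 1 < b) :
    Tendsto
      (fun γ : ℝ =>
        (A + σ) / (-Real.log (ρ₀ * Real.exp (-σ * γ))) *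
          (1 + Real.logb 2
            (b * γ * (A + σ) / Real.log (1 + ρ₀ * Real.exp (-(σ + A) * γ)))))
      atTop
      (nhds ((A + σ) / Real.log 2 * (1 + A / σ))) := by
  obtain ⟨hρ, hρ1⟩ := hρ₀
  have hc : 0 < A + σ := by positivity
  have hlog2 : 0 < Real.log 2 := Real.log_pos one_lt_two
  have hlogρ : Real.log ρ₀ < 0 := Real.log_neg hρ hρ1
  have hx : Tendsto (fun γ : ℝ => ρ₀ * Real.exp (-(σ + A) * γ)) atTop
      (nhdsWithin 0 {0}ᶜ) := by
    refine tendsto_nhdsWithin_iff.mpr ⟨?_, .of_forall fun γ => by simp [hρ.ne']⟩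
    simpa using (Real.tendsto_exp_atBot.comp
      (tendsto_id.const_mul_atTop_of_neg (show -(σ + A) < 0 by linarith))).const_mul ρ₀
  have hq := (tendsto_log_one_add_div_self.comp hx).log one_ne_zero
  have hinv := tendsto_inv_atTop_zero (𝕜 := ℝ)
  have hlog : Tendsto (fun γ : ℝ => Real.log γ / γ) atTop (nhds 0) :=
    Real.isLittleO_log_id_atTop.tendsto_div_nhds_zero
  have key := ((tendsto_const_nhds (x := A + σ)).div
      ((hinv.const_mul (-Real.log ρ₀)).add_const σ) (by simpa using hσ.ne')).mul
    (hinv.add ((((((hinv.const_mul (Real.log b + Real.log (A + σ) - Real.log ρ₀)).add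
      hlog).sub (hq.mul hinv)).add_const (A + σ))).div_const (Real.log 2)))
  have hlim : (A + σ) / (-Real.log ρ₀ * 0 + σ) *
      (0 + ((Real.log b + Real.log (A + σ) - Real.log ρ₀) * 0 + 0 - Real.log 1 * 0 + (A + σ))
        / Real.log 2) = (A + σ) / Real.log 2 * (1 + A / σ) := by
    simp only [mul_zero, zero_add, add_zero, sub_zero]
    field_simp
    ring
  rw [hlim] at key
  refine key.congr' ?_
  filter_upwards [eventually_gt_atTop 0] with γ hγ
  have hxpos : 0 < ρ₀ * Real.exp (-(σ + A) * γ) := by positivity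
  have hL : 0 < Real.log (1 + ρ₀ * Real.exp (-(σ + A) * γ)) := Real.log_pos (by linarith)
  have hlogx : Real.log (ρ₀ * Real.exp (-(σ + A) * γ)) = Real.log ρ₀ - (σ + A) * γ := by
    rw [Real.log_mul hρ.ne' (Real.exp_pos _).ne', Real.log_exp]
    ring
  have hden : 0 < -Real.log ρ₀ + σ * γ := by nlinarith [mul_pos hσ hγ]
  have hb0 : b ≠ 0 := by positivity
  simp only [Function.comp_apply, Pi.div_apply]
  rw [Real.log_div hL.ne' hxpos.ne', hlogx, Real.logb, Real.log_div (by positivity) hL.ne',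
    Real.log_mul (by positivity) hc.ne', Real.log_mul hb0 hγ.ne',
    Real.log_mul hρ.ne' (Real.exp_pos _).ne', Real.log_exp]
  have h1 : -Real.log ρ₀ * γ⁻¹ + σ = (-Real.log ρ₀ + σ * γ) / γ := by field_simp
  have h2 : -(Real.log ρ₀ + -σ * γ) = -Real.log ρ₀ + σ * γ := by ring
  rw [h1, h2]
  generalize -Real.log ρ₀ + σ * γ = d at hden
  field_simp
  ring
end

section
/- Let A > 0, γ > 0, ρ₀ ∈ (0,1), and ν ≥ 1. Then the ratio of F(σ) = (A + σ)/(ln ν + ln(2 + e^{σγ}/ρ₀)) · log₂((e^{Aγ} − 1)/(ρ₀·e^{-σγ})) to G(σ) = ((A + σ)/ln 2) · (1 + log₂(e^{Aγ} − 1)/(−log₂(ρ₀·e^{-σγ}))) tends to 1 as σ → ∞ (along σ large enough that both denominators are positive). -/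
open Filter

/-- `log (2 + exp x)` differs from `x` by a bounded amount at infinity, so adding a constant
leaves it asymptotically equivalent to `x`. -/
theorem tendsto_div_const_add_log_two_add_exp (a : ℝ) :
    Tendsto (fun x : ℝ => x / (a + Real.log (2 + Real.exp x))) atTop (nhds 1) := by
  have h₁ : Tendsto (fun x : ℝ => a + Real.log (1 + 2 * Real.exp (-x))) atTop
      (nhds (a + Real.log (1 + 2 * 0))) :=
    tendsto_const_nhds.add
      ((tendsto_const_nhds.add (Real.tendsto_exp_neg_atTop_nhds_zero.const_mul 2)).log (by norm_num))
  have h₂ := ((h₁.div_atTop tendsto_id).const_add 1).inv₀ (by norm_num)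
  rw [add_zero, inv_one] at h₂
  refine h₂.congr' ?_
  filter_upwards [eventually_gt_atTop 0] with x hx
  have h₃ : 2 + Real.exp x = Real.exp x * (1 + 2 * Real.exp (-x)) := by
    rw [Real.exp_neg]
    field_simp
    ring
  rw [h₃, Real.log_mul (by positivity) (by positivity), Real.log_exp, ← inv_div, id]
  field_simp
  ring

/-- Approximation claim of Theorem 4: the exact necessary transmission-rate bound `F σ` is
asymptotically equivalent, as the convergence rate `σ → ∞`, to the simplified expression
`G σ = ((A+σ)/ln 2)(1 + log₂(e^{Aγ}−1)/(−log₂(ρ₀ e^{-σγ})))`, i.e. `F σ / G σ → 1`. -/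
theorem necessary_rate_approximation_ratio_tendsto_one
    (A γ ρ₀ ν : ℝ) (hA : 0 < A) (hγ : 0 < γ) (hρ₀ : ρ₀ ∈ Set.Ioo (0 : ℝ) 1) (hν : 1 ≤ ν) :
    Tendsto
      (fun σ : ℝ =>
        ((A + σ) / (Real.log ν + Real.log (2 + Real.exp (σ * γ) / ρ₀)) *
            Real.logb 2 ((Real.exp (A * γ) - 1) / (ρ₀ * Real.exp (-σ * γ)))) /
          ((A + σ) / Real.log 2 *
            (1 + Real.logb 2 (Real.exp (A * γ) - 1) /
              (-Real.logb 2 (ρ₀ * Real.exp (-σ * γ))))))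
      atTop (nhds 1) := by
  have hρ := hρ₀.1
  have hlim : Tendsto (fun σ : ℝ => σ * γ - Real.log ρ₀) atTop atTop :=
    tendsto_atTop_add_const_right _ _ (tendsto_id.atTop_mul_const hγ)
  refine ((tendsto_div_const_add_log_two_add_exp (Real.log ν)).comp hlim).congr' ?_
  filter_upwards [eventually_gt_atTop 0, hlim.eventually_gt_atTop 0,
    hlim.eventually_gt_atTop (-Real.log (Real.exp (A * γ) - 1))] with σ hσ hL hc
  have hE : 0 < Real.exp (A * γ) - 1 := sub_pos.2 (Real.one_lt_exp_iff.2 (by positivity))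
  have hexp : Real.exp (σ * γ) / ρ₀ = Real.exp (σ * γ - Real.log ρ₀) := by
    rw [Real.exp_sub, Real.exp_log hρ]
  have hlog : Real.log (ρ₀ * Real.exp (-σ * γ)) = -(σ * γ - Real.log ρ₀) := by
    rw [Real.log_mul hρ.ne' (Real.exp_ne_zero _), Real.log_exp]
    ring
  simp only [Function.comp_apply, Real.logb]
  rw [Real.log_div hE.ne' (by positivity), hlog, hexp]
  generalize σ * γ - Real.log ρ₀ = L at *
  generalize Real.log (Real.exp (A * γ) - 1) = c at *
  have hD : 0 < Real.log ν + Real.log (2 + Real.exp L) :=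
    add_pos_of_nonneg_of_pos (Real.log_nonneg hν)
      (Real.log_pos (by linarith [Real.exp_pos L]))
  have h2 : 0 < Real.log 2 := Real.log_pos one_lt_two
  have hAσ : 0 < A + σ := by positivity
  have hcL : L + c ≠ 0 := by linarith
  have hG : 1 + c / Real.log 2 / (-(-L / Real.log 2)) = (L + c) / L := by
    field_simp
  rw [hG, sub_neg_eq_add, add_comm c L]
  field_simp
end
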